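/- Let σ₃^C denote the F-algebra automorphism id_B ⊗ σ₃ of C = B ⊗_F K₃. Fix a K₃-generator y ∈ K and set s = ((y − τ₃(y))²)⁻¹·(Φ̃₁(y) − Φ̃₂(τ₃(y)))² and t = ((y − τ₃(y))²)⁻¹·(Φ̃₁(y)·Φ̃₂(y) − Φ̃₂(y)·Φ̃₁(y)) in C. Then s + σ₃^C(s) = 1 and s·σ₃^C(s) + t² = 0. -/

import Mathlib

open TensorProduct

set_option synthInstance.maxHeartbeats 1000000
set_option maxHeartbeats 2000000

universe u

/-- `τ₃ = σ₁ ⊗ σ₂` on `K = K₁ ⊗[F] K₂`. -/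
noncomputable def tau3 {F : Type u} [Field F] {K₁ K₂ : Type u}
    [CommRing K₁] [CommRing K₂] [Algebra F K₁] [Algebra F K₂]
    (σ₁ : K₁ ≃ₐ[F] K₁) (σ₂ : K₂ ≃ₐ[F] K₂) :
    (K₁ ⊗[F] K₂) ≃ₐ[F] (K₁ ⊗[F] K₂) :=
  Algebra.TensorProduct.congr σ₁ σ₂

/-- `τ₁ = id ⊗ σ₂` on `K = K₁ ⊗[F] K₂`. -/
noncomputable def tau1 {F : Type u} [Field F] {K₁ K₂ : Type u}
    [CommRing K₁] [CommRing K₂] [Algebra F K₁] [Algebra F K₂]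
    (σ₂ : K₂ ≃ₐ[F] K₂) :
    (K₁ ⊗[F] K₂) ≃ₐ[F] (K₁ ⊗[F] K₂) :=
  Algebra.TensorProduct.congr AlgEquiv.refl σ₂

/-- `K₃ ⊆ K₁ ⊗[F] K₂`, the subalgebra of `τ₃`-fixed elements. -/
noncomputable def K3 {F : Type u} [Field F] {K₁ K₂ : Type u}
    [CommRing K₁] [CommRing K₂] [Algebra F K₁] [Algebra F K₂]
    (σ₁ : K₁ ≃ₐ[F] K₁) (σ₂ : K₂ ≃ₐ[F] K₂) : Subalgebra F (K₁ ⊗[F] K₂) :=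
  AlgHom.equalizer (tau3 σ₁ σ₂).toAlgHom (AlgHom.id F _)

theorem aux_delta {F : Type u} [Field F] {K : Type u} [CommRing K] [Algebra F K]
    [Algebra.Etale F K] (hdim : Module.finrank F K = 2)
    (σ : K ≃ₐ[F] K) (hσ : ∀ x : K, σ (σ x) = x)
    (hfix : ∀ x : K, σ x = x ↔ ∃ a : F, algebraMap F K a = x) :
    ∃ x : K, IsUnit (x - σ x) := by
  have hred : IsReduced K := Algebra.FormallyUnramified.isReduced_of_field F K
  have hex : ∃ x : K, σ x ≠ x := by
    by_contra hcon
    push Not at hcon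
    have h1 : Module.finrank F K ≤ 1 := by
      apply finrank_le_one (1 : K)
      intro w
      obtain ⟨a, ha⟩ := (hfix w).1 (hcon w)
      exact ⟨a, by rw [← ha, Algebra.algebraMap_eq_smul_one]⟩
    omega
  obtain ⟨x, hx⟩ := hex
  refine ⟨x, ?_⟩
  have hne : x - σ x ≠ 0 := fun h0 => hx (sub_eq_zero.1 h0).symm
  have hs : σ ((x - σ x) ^ 2) = (x - σ x) ^ 2 := by
    rw [map_pow, map_sub, hσ]; ring
  obtain ⟨a, ha⟩ := (hfix _).1 hs
  have ha0 : a ≠ 0 := by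
    rintro rfl
    rw [map_zero] at ha
    exact hne (pow_eq_zero_iff (two_ne_zero)|>.1 ha.symm)
  have hu : IsUnit ((x - σ x) ^ 2) := by
    rw [← ha]; exact (IsUnit.mk0 a ha0).map _
  exact (isUnit_pow_iff two_ne_zero).1 hu

theorem aux_mem {F : Type u} [Field F] {K₁ K₂ : Type u}
    [CommRing K₁] [CommRing K₂] [Algebra F K₁] [Algebra F K₂]
    (σ₁ : K₁ ≃ₐ[F] K₁) (σ₂ : K₂ ≃ₐ[F] K₂) (k : K₁ ⊗[F] K₂) :
    k ∈ K3 σ₁ σ₂ ↔ tau3 σ₁ σ₂ k = k := Iff.rfl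

theorem aux_tr {F : Type u} [Field F] {K₁ K₂ : Type u}
    [CommRing K₁] [CommRing K₂] [Algebra F K₁] [Algebra F K₂]
    (σ₁ : K₁ ≃ₐ[F] K₁) (σ₂ : K₂ ≃ₐ[F] K₂)
    (hσ₁ : ∀ x : K₁, σ₁ (σ₁ x) = x) (hσ₂ : ∀ x : K₂, σ₂ (σ₂ x) = x)
    (x : K₁) (z : K₂) : x ⊗ₜ[F] z + σ₁ x ⊗ₜ[F] σ₂ z ∈ K3 σ₁ σ₂ := by
  rw [aux_mem, map_add]
  simp [tau3, hσ₁, hσ₂, add_comm]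

theorem aux_ext1 {F : Type u} [Field F] {K₁ K₂ : Type u}
    [CommRing K₁] [CommRing K₂] [Algebra F K₁] [Algebra F K₂]
    (σ₁ : K₁ ≃ₐ[F] K₁) (σ₂ : K₂ ≃ₐ[F] K₂)
    (hσ₁ : ∀ x : K₁, σ₁ (σ₁ x) = x) (hσ₂ : ∀ x : K₂, σ₂ (σ₂ x) = x)
    (hu : ∃ x : K₁, IsUnit (x - σ₁ x))
    {A : Type u} [Ring A] [Algebra F A] (f g : (K₁ ⊗[F] K₂) →ₐ[F] A)
    (h1 : ∀ x : K₁, f (x ⊗ₜ[F] (1 : K₂)) = g (x ⊗ₜ[F] (1 : K₂)))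
    (h3 : ∀ c ∈ K3 σ₁ σ₂, f c = g c) : f = g := by
  obtain ⟨x, hx⟩ := hu
  apply Algebra.TensorProduct.ext'
  intro a z
  have e0 : (a ⊗ₜ[F] z : K₁ ⊗[F] K₂) = (a ⊗ₜ 1) * (1 ⊗ₜ z) := by simp
  rw [e0, map_mul, map_mul, h1]
  congr 1
  have hU : IsUnit (g ((x - σ₁ x) ⊗ₜ[F] (1 : K₂))) := by
    have := hx.map ((g.comp (Algebra.TensorProduct.includeLeft : K₁ →ₐ[F] K₁ ⊗[F] K₂)))
    simpa using this
  apply hU.mul_left_cancel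
  have hz : ((1 : K₁) ⊗ₜ[F] (z + σ₂ z) : K₁ ⊗[F] K₂) ∈ K3 σ₁ σ₂ := by
    have := aux_tr σ₁ σ₂ hσ₁ hσ₂ 1 z
    rwa [map_one, ← TensorProduct.tmul_add] at this
  have e1 : (((x - σ₁ x) ⊗ₜ[F] (1 : K₂)) * ((1 : K₁) ⊗ₜ[F] z) : K₁ ⊗[F] K₂)
      = (x ⊗ₜ[F] z + σ₁ x ⊗ₜ[F] σ₂ z) - (σ₁ x ⊗ₜ 1) * (1 ⊗ₜ (z + σ₂ z)) := by
    simp only [Algebra.TensorProduct.tmul_mul_tmul, mul_one, one_mul]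
    simp only [TensorProduct.sub_tmul,
      TensorProduct.tmul_add]
    abel
  have e2 := congrArg f e1
  have e3 := congrArg g e1
  rw [map_mul, map_sub, map_mul, h1, h1, h3 _ hz, h3 _ (aux_tr σ₁ σ₂ hσ₁ hσ₂ x z)] at e2
  rw [map_mul, map_sub, map_mul] at e3
  rw [e2, e3]

theorem aux_ext2 {F : Type u} [Field F] {K₁ K₂ : Type u}
    [CommRing K₁] [CommRing K₂] [Algebra F K₁] [Algebra F K₂]
    (σ₁ : K₁ ≃ₐ[F] K₁) (σ₂ : K₂ ≃ₐ[F] K₂)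
    (hσ₁ : ∀ x : K₁, σ₁ (σ₁ x) = x) (hσ₂ : ∀ x : K₂, σ₂ (σ₂ x) = x)
    (hu : ∃ x : K₂, IsUnit (x - σ₂ x))
    {A : Type u} [Ring A] [Algebra F A] (f g : (K₁ ⊗[F] K₂) →ₐ[F] A)
    (h1 : ∀ x : K₂, f ((1 : K₁) ⊗ₜ[F] x) = g ((1 : K₁) ⊗ₜ[F] x))
    (h3 : ∀ c ∈ K3 σ₁ σ₂, f c = g c) : f = g := by
  obtain ⟨x, hx⟩ := hu
  apply Algebra.TensorProduct.ext'
  intro z a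
  have e0 : (z ⊗ₜ[F] a : K₁ ⊗[F] K₂) = (1 ⊗ₜ a) * (z ⊗ₜ 1) := by simp
  rw [e0, map_mul, map_mul, h1]
  congr 1
  have hU : IsUnit (g ((1 : K₁) ⊗ₜ[F] (x - σ₂ x))) := by
    have := hx.map ((g.comp (Algebra.TensorProduct.includeRight : K₂ →ₐ[F] K₁ ⊗[F] K₂)))
    simpa using this
  apply hU.mul_left_cancel
  have hz : ((z + σ₁ z) ⊗ₜ[F] (1 : K₂) : K₁ ⊗[F] K₂) ∈ K3 σ₁ σ₂ := by
    have := aux_tr σ₁ σ₂ hσ₁ hσ₂ z 1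
    rwa [map_one, ← TensorProduct.add_tmul] at this
  have e1 : (((1 : K₁) ⊗ₜ[F] (x - σ₂ x)) * (z ⊗ₜ[F] (1 : K₂)) : K₁ ⊗[F] K₂)
      = (z ⊗ₜ[F] x + σ₁ z ⊗ₜ[F] σ₂ x) - (1 ⊗ₜ σ₂ x) * ((z + σ₁ z) ⊗ₜ 1) := by
    simp only [Algebra.TensorProduct.tmul_mul_tmul, mul_one, one_mul]
    simp only [TensorProduct.tmul_sub,
      TensorProduct.add_tmul]
    abel
  have e2 := congrArg f e1
  have e3 := congrArg g e1
  rw [map_mul, map_sub, map_mul, h1, h1, h3 _ hz, h3 _ (aux_tr σ₁ σ₂ hσ₁ hσ₂ z x)] at e2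
  rw [map_mul, map_sub, map_mul] at e3
  rw [e2, e3]

/-- The noncommutative computation. -/
theorem aux_ring {C : Type u} [Ring C] (a b T N D i : C)
    (hTa : T * a = a * T) (hTb : T * b = b * T)
    (hic : ∀ z, i * z = z * i)
    (ha : a * a = T * a - N) (hb : b * b = T * b - N)
    (hD : D = T * T - 4 * N) (hi : i * D = 1) :
    i * (a - (T - b)) ^ 2 + i * (a - b) ^ 2 = 1 ∧
    (i * (a - (T - b)) ^ 2) * (i * (a - b) ^ 2) + (i * (a * b - b * a)) ^ 2 = 0 := by
  constructor
  · rw [← mul_add, ← hi, hD]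
    congr 1
    have : (a - (T - b)) ^ 2 + (a - b) ^ 2
        = 2 * (a * a) + 2 * (b * b) - T * a - a * T - T * b - b * T + T * T := by noncomm_ring
    rw [this, ha, hb, ← hTa, ← hTb]
    noncomm_ring
  · have huv : (a - (T - b)) * (a - b) = -(a * b - b * a) := by
      have : (a - (T - b)) * (a - b) = a * a - b * b - a * b + b * a - T * a + T * b := by
        noncomm_ring
      rw [this, ha, hb]; noncomm_ring
    have hvu : (a - b) * (a - (T - b)) = a * b - b * a := by
      have : (a - b) * (a - (T - b)) = a * a - b * b + a * b - b * a - a * T + b * T := by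
        noncomm_ring
      rw [this, ha, hb, hTa, hTb]; noncomm_ring
    have hw : (a - (T - b)) ^ 2 * (a - b) ^ 2 = -(a * b - b * a) ^ 2 := by
      have h1 : (a - (T - b)) ^ 2 * (a - b) ^ 2
          = (a - (T - b)) * ((a - (T - b)) * (a - b)) * (a - b) := by
        simp only [pow_two, mul_assoc]
      rw [h1, huv, ← hvu]
      have h2 : (a - (T - b)) * -((a - b) * (a - (T - b))) * (a - b)
          = -(((a - (T - b)) * (a - b)) * ((a - (T - b)) * (a - b))) := by
        simp only [mul_neg, neg_mul, mul_assoc]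
      rw [h2, huv, ← hvu, neg_mul_neg, pow_two]
    have hcom : ∀ p q : C, (i * p) * (i * q) = (i * i) * (p * q) := by
      intro p q
      rw [mul_assoc, ← mul_assoc p, ← hic p]; simp only [mul_assoc]
    rw [hcom, pow_two (i * _), hcom, hw, ← mul_add, ← pow_two (a * b - b * a)]
    simp

/-- The relations `s + σ₃^C(s) = 1` and `s·σ₃^C(s) + t² = 0`,
where `σ₃^C = id_B ⊗ σ₃` on `C = B ⊗[F] K₃`. -/
theorem s_plus_conj_eq_one_and_s_mul_conj_plus_tsq_eq_zero
    (F : Type u) [Field F] (K₁ K₂ : Type u)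
    [CommRing K₁] [CommRing K₂] [Algebra F K₁] [Algebra F K₂]
    [Algebra.Etale F K₁] [Algebra.Etale F K₂]
    (hdim₁ : Module.finrank F K₁ = 2) (hdim₂ : Module.finrank F K₂ = 2)
    (σ₁ : K₁ ≃ₐ[F] K₁) (σ₂ : K₂ ≃ₐ[F] K₂)
    (hσ₁ : ∀ x : K₁, σ₁ (σ₁ x) = x) (hσ₂ : ∀ x : K₂, σ₂ (σ₂ x) = x)
    (hσ₁fix : ∀ x : K₁, σ₁ x = x ↔ ∃ a : F, algebraMap F K₁ a = x)
    (hσ₂fix : ∀ x : K₂, σ₂ x = x ↔ ∃ a : F, algebraMap F K₂ a = x)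
    -- `σ₃`, the restriction of `τ₁ = id ⊗ σ₂` to `K₃`
    (σ₃ : K3 σ₁ σ₂ ≃ₐ[F] K3 σ₁ σ₂)
    (hσ₃ : ∀ c : K3 σ₁ σ₂, ((σ₃ c : K3 σ₁ σ₂) : K₁ ⊗[F] K₂) = tau1 σ₂ (c : K₁ ⊗[F] K₂))
    -- the central simple algebra `B` of dimension `4h²`
    (h : ℕ) (hh : 0 < h)
    (B : Type u) [Ring B] [Algebra F B] [FiniteDimensional F B]
    [Algebra.IsCentral F B] [IsSimpleRing B]
    (hB : Module.finrank F B = 4 * h ^ 2)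
    (Φ₁ : K₁ →ₐ[F] B) (Φ₂ : K₂ →ₐ[F] B)
    -- `Φ̃₁, Φ̃₂ : K → C = B ⊗[F] K₃`, the unique `K₃`-algebra extensions of `Φ₁, Φ₂`
    (Φt₁ Φt₂ : (K₁ ⊗[F] K₂) →ₐ[F] B ⊗[F] (K3 σ₁ σ₂))
    (hΦt₁ : ∀ x : K₁, Φt₁ (x ⊗ₜ[F] (1 : K₂)) = Φ₁ x ⊗ₜ[F] (1 : K3 σ₁ σ₂))
    (hΦt₂ : ∀ x : K₂, Φt₂ ((1 : K₁) ⊗ₜ[F] x) = Φ₂ x ⊗ₜ[F] (1 : K3 σ₁ σ₂))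
    (hΦt₁c : ∀ c : K3 σ₁ σ₂, Φt₁ (c : K₁ ⊗[F] K₂) = (1 : B) ⊗ₜ[F] c)
    (hΦt₂c : ∀ c : K3 σ₁ σ₂, Φt₂ (c : K₁ ⊗[F] K₂) = (1 : B) ⊗ₜ[F] c)
    -- a `K₃`-generator `y` of `K`
    (y : K₁ ⊗[F] K₂)
    (hygen : ∀ k : K₁ ⊗[F] K₂, ∃ a b : K3 σ₁ σ₂, k = (a : K₁ ⊗[F] K₂) + (b : K₁ ⊗[F] K₂) * y)
    (hyunit : IsUnit (y - tau3 σ₁ σ₂ y)) :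
    let σC := Algebra.TensorProduct.map (AlgHom.id F B) σ₃.toAlgHom
    let s := Ring.inverse (Φt₁ ((y - tau3 σ₁ σ₂ y) ^ 2)) * (Φt₁ y - Φt₂ (tau3 σ₁ σ₂ y)) ^ 2
    let t := Ring.inverse (Φt₁ ((y - tau3 σ₁ σ₂ y) ^ 2)) * (Φt₁ y * Φt₂ y - Φt₂ y * Φt₁ y)
    s + σC s = 1 ∧ s * σC s + t ^ 2 = 0 := by
  intro σC s t
  have hu1 := aux_delta hdim₁ σ₁ hσ₁ hσ₁fix
  have hu2 := aux_delta hdim₂ σ₂ hσ₂ hσ₂fix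
  have hτ : ∀ k, tau3 σ₁ σ₂ (tau3 σ₁ σ₂ k) = k := by
    intro k
    induction k with
    | zero => simp
    | tmul x z => simp [tau3, hσ₁, hσ₂]
    | add p q hp hq => rw [map_add, map_add, hp, hq]
  have hτ13 : ∀ k, tau1 σ₂ (tau3 σ₁ σ₂ k) = tau3 σ₁ σ₂ (tau1 σ₂ k) := by
    intro k
    induction k with
    | zero => simp
    | tmul x z => simp [tau1, tau3]
    | add p q hp hq => simp only [map_add, hp, hq]
  have hf1 : σC.comp Φt₁ = Φt₁.comp (tau1 σ₂ : (K₁ ⊗[F] K₂) ≃ₐ[F] (K₁ ⊗[F] K₂)).toAlgHom := by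
    apply aux_ext1 σ₁ σ₂ hσ₁ hσ₂ hu1
    · intro x
      have : tau1 σ₂ (x ⊗ₜ[F] (1 : K₂)) = x ⊗ₜ[F] (1 : K₂) := by simp [tau1]
      change σC (Φt₁ _) = Φt₁ (tau1 σ₂ _)
      rw [this, hΦt₁]
      simp [σC]
    · intro c hc
      change σC (Φt₁ _) = Φt₁ (tau1 σ₂ _)
      have h1 := hΦt₁c ⟨c, hc⟩
      have h2 := hΦt₁c (σ₃ ⟨c, hc⟩)
      rw [hσ₃] at h2
      change Φt₁ c = _ at h1
      change Φt₁ (tau1 σ₂ c) = _ at h2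
      rw [h1, h2]
      simp [σC]
  have hf2 : σC.comp Φt₂ = Φt₂.comp ((tau3 σ₁ σ₂).trans (tau1 σ₂)).toAlgHom := by
    apply aux_ext2 σ₁ σ₂ hσ₁ hσ₂ hu2
    · intro x
      have : tau1 σ₂ (tau3 σ₁ σ₂ ((1 : K₁) ⊗ₜ[F] x)) = (1 : K₁) ⊗ₜ[F] x := by
        simp [tau1, tau3, hσ₂]
      change σC (Φt₂ ((1 : K₁) ⊗ₜ[F] x)) = Φt₂ (tau1 σ₂ (tau3 σ₁ σ₂ ((1 : K₁) ⊗ₜ[F] x)))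
      rw [this, hΦt₂]
      simp [σC]
    · intro c hc
      change σC (Φt₂ _) = Φt₂ (tau1 σ₂ (tau3 σ₁ σ₂ _))
      rw [(aux_mem σ₁ σ₂ c).1 hc]
      have h1 := hΦt₂c ⟨c, hc⟩
      have h2 := hΦt₂c (σ₃ ⟨c, hc⟩)
      rw [hσ₃] at h2
      change Φt₂ c = _ at h1
      change Φt₂ (tau1 σ₂ c) = _ at h2
      rw [h1, h2]
      simp [σC]
  have hg1 : ∀ k, σC (Φt₁ k) = Φt₁ (tau1 σ₂ k) := fun k => DFunLike.congr_fun hf1 k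
  have hg2 : ∀ k, σC (Φt₂ (tau3 σ₁ σ₂ k)) = Φt₂ (tau1 σ₂ k) := by
    intro k
    have : σC (Φt₂ (tau3 σ₁ σ₂ k)) = Φt₂ (tau1 σ₂ (tau3 σ₁ σ₂ (tau3 σ₁ σ₂ k))) :=
      DFunLike.congr_fun hf2 (tau3 σ₁ σ₂ k)
    rw [this, hτ]
  have hcent : ∀ (c : K3 σ₁ σ₂) (z : B ⊗[F] (K3 σ₁ σ₂)),
      ((1 : B) ⊗ₜ[F] c) * z = z * ((1 : B) ⊗ₜ[F] c) := by
    intro c z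
    induction z with
    | zero => simp
    | tmul x w => simp [mul_comm]
    | add p q hp hq => rw [mul_add, add_mul, hp, hq]
  have h12 : ∀ c ∈ K3 σ₁ σ₂, Φt₂ c = Φt₁ c := fun c hc =>
    (hΦt₂c ⟨c, hc⟩).trans (hΦt₁c ⟨c, hc⟩).symm
  have hcen : ∀ c ∈ K3 σ₁ σ₂, ∀ z, Φt₁ c * z = z * Φt₁ c := by
    intro c hc z
    have h1 : Φt₁ c = _ := hΦt₁c ⟨c, hc⟩
    rw [h1]; exact hcent _ z
  obtain ⟨α, β, hαβ⟩ := hygen (tau1 σ₂ y)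
  have hTm : y + tau3 σ₁ σ₂ y ∈ K3 σ₁ σ₂ := by
    rw [aux_mem, map_add, hτ, add_comm]
  have hNm : y * tau3 σ₁ σ₂ y ∈ K3 σ₁ σ₂ := by
    rw [aux_mem, map_mul, hτ, mul_comm]
  have hDm : (y - tau3 σ₁ σ₂ y) ^ 2 ∈ K3 σ₁ σ₂ := by
    rw [aux_mem, map_pow, map_sub, hτ]; ring
  have hα3 : tau3 σ₁ σ₂ (α : K₁ ⊗[F] K₂) = α := (aux_mem σ₁ σ₂ _).1 α.2
  have hβ3 : tau3 σ₁ σ₂ (β : K₁ ⊗[F] K₂) = β := (aux_mem σ₁ σ₂ _).1 β.2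
  have hτD : tau1 σ₂ ((y - tau3 σ₁ σ₂ y) ^ 2)
      = (β : K₁ ⊗[F] K₂) ^ 2 * (y - tau3 σ₁ σ₂ y) ^ 2 := by
    rw [map_pow, map_sub, hτ13, hαβ, map_add, map_mul, hα3, hβ3]; ring
  have hDu : IsUnit (Φt₁ ((y - tau3 σ₁ σ₂ y) ^ 2)) := (hyunit.pow 2).map Φt₁
  have hiD := Ring.inverse_mul_cancel _ hDu
  have hDi := Ring.mul_inverse_cancel _ hDu
  have hDc := hcen _ hDm
  have hσD : σC (Φt₁ ((y - tau3 σ₁ σ₂ y) ^ 2))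
      = Φt₁ β ^ 2 * Φt₁ ((y - tau3 σ₁ σ₂ y) ^ 2) := by
    rw [hg1, hτD, map_mul, map_pow]
  have hTb : Φt₂ (tau3 σ₁ σ₂ y) = Φt₁ (y + tau3 σ₁ σ₂ y) - Φt₂ y := by
    rw [← h12 _ hTm, map_add]; abel
  have hσu : σC (Φt₁ y - Φt₂ (tau3 σ₁ σ₂ y)) = Φt₁ β * (Φt₁ y - Φt₂ y) := by
    rw [map_sub, hg1, hg2, hαβ, map_add, map_add, map_mul, map_mul, h12 _ α.2, h12 _ β.2, mul_sub]
    abel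
  have hβc := hcen _ β.2
  have ha : Φt₁ y * Φt₁ y
      = Φt₁ (y + tau3 σ₁ σ₂ y) * Φt₁ y - Φt₁ (y * tau3 σ₁ σ₂ y) := by
    rw [← map_mul, ← map_mul, ← map_sub]; congr 1; ring
  have hb : Φt₂ y * Φt₂ y
      = Φt₁ (y + tau3 σ₁ σ₂ y) * Φt₂ y - Φt₁ (y * tau3 σ₁ σ₂ y) := by
    rw [← h12 _ hTm, ← h12 _ hNm, ← map_mul, ← map_mul, ← map_sub]; congr 1; ring
  have hD : Φt₁ ((y - tau3 σ₁ σ₂ y) ^ 2)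
      = Φt₁ (y + tau3 σ₁ σ₂ y) * Φt₁ (y + tau3 σ₁ σ₂ y) - 4 * Φt₁ (y * tau3 σ₁ σ₂ y) := by
    have h4 : (4 : B ⊗[F] (K3 σ₁ σ₂)) = Φt₁ 4 := (map_ofNat Φt₁ 4).symm
    rw [h4, ← map_mul, ← map_mul, ← map_sub]; congr 1; ring
  have hTc := hcen _ hTm
  clear_value σC
  have hs : σC s = Ring.inverse (Φt₁ ((y - tau3 σ₁ σ₂ y) ^ 2)) * (Φt₁ y - Φt₂ y) ^ 2 := by
    have hj := congrArg σC hiD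
    rw [map_mul, map_one, hσD] at hj
    change σC (_ * _) = _
    rw [map_mul, map_pow σC, hσu]
    have h2 : (Φt₁ β * (Φt₁ y - Φt₂ y)) ^ 2 = Φt₁ β ^ 2 * (Φt₁ y - Φt₂ y) ^ 2 :=
      Commute.mul_pow (hβc _) 2
    rw [h2, ← mul_assoc]
    congr 1
    calc _ = (σC (Ring.inverse (Φt₁ ((y - tau3 σ₁ σ₂ y) ^ 2)))
            * (Φt₁ β ^ 2 * Φt₁ ((y - tau3 σ₁ σ₂ y) ^ 2)))
            * Ring.inverse (Φt₁ ((y - tau3 σ₁ σ₂ y) ^ 2)) := by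
          rw [mul_assoc, mul_assoc (Φt₁ β ^ 2), hDi, mul_one]
      _ = _ := by rw [hj, one_mul]
  rw [hs]
  have key := aux_ring (Φt₁ y) (Φt₂ y) (Φt₁ (y + tau3 σ₁ σ₂ y)) (Φt₁ (y * tau3 σ₁ σ₂ y))
    (Φt₁ ((y - tau3 σ₁ σ₂ y) ^ 2)) (Ring.inverse (Φt₁ ((y - tau3 σ₁ σ₂ y) ^ 2)))
    (hTc _) (hTc _) (fun z => by
      apply hDu.mul_left_cancel
      rw [← mul_assoc, hDi, one_mul, ← mul_assoc, hDc, mul_assoc, hDi, mul_one]) ha hb hD hiD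
  rw [← hTb] at key
  exact key
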